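/- arXiv:0803.1006 — 2 statements merged into one kernel-verified Lean document; each statement's English description precedes it below -/
import Mathlib

section
/- Let T, V, E, Z be real Banach spaces, t₀ ∈ T, v₀ ∈ V, ε₀ ∈ E, r > 0, and let F : B_r(t₀) × B_r(v₀) × B_r(ε₀) → Z satisfy: (i) F(t₀,v₀,ε₀) = 0; (ii) F is continuous at (t₀,v₀,ε₀); (iii) F is Fréchet differentiable at (t₀,v₀,ε₀) and F'_t(t₀,v₀,ε₀) : T → Z has a bounded inverse; (iv) there is L_{ε,v} → 0 as (ε,v) → (ε₀,v₀) with ‖F(t₁,v,ε) − F(t₂,v,ε) − F(t₁,v₀,ε₀) + F(t₂,v₀,ε₀)‖ ≤ L_{ε,v}‖t₁ − t₂‖ for all t₁,t₂ ∈ B_r(t₀), v ∈ B_r(v₀), ε ∈ B_r(ε₀); (v) there are K > 0 and L_ε → 0 as ε → ε₀ with ‖F(t₁,v₂,ε) − F(t₁,v₁,ε) − F(t₂,v₂,ε₀) + F(t₂,v₁,ε₀)‖ ≤ (L_ε + K‖t₁ − t₂‖)‖v₁ − v₂‖ for all t₁,t₂ ∈ B_r(t₀), v₁,v₂ ∈ B_r(v₀),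 ε ∈ B_r(ε₀); (vi) (t,v) ↦ F(t,v,ε₀) is continuously differentiable on B_r(t₀) × B_r(v₀); (vii) F is Lipschitz on B_r(t₀) × B_r(v₀) × B_r(ε₀); (viii) there is a map J : T → T* (the continuous dual) such that J(t)(t) = ‖t‖ for every t ∈ T and J is bounded on bounded subsets of T. Then there exist α > 0 and β > 0 such that for every (v,ε) ∈ B_α((v₀,ε₀)) the equation F(t,v,ε) = 0 has a unique solution t = θ(v,ε) in B_β(t₀); moreover, for every Δ > 0 there exists δ > 0 such that ‖θ(v₁,ε) − θ(v₂,ε)‖ ≤ ( ‖[F'_t(t₀,v₀,ε₀)]⁻¹ ∘ F'_v(t₀,v₀,ε₀)‖ + Δ )‖v₁ − v₂‖ for all v₁,v₂ ∈ B_δ(v₀) and ε ∈ B_δ(ε₀). -/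
open Metric Filter

/-- Theorem 2 of the paper: a Lipschitz perturbation theorem for implicit
functions, including the existence of the implicit function `θ(v,ε)` and the
Lipschitz estimate with constant close to
`‖[F'_t(t₀,v₀,ε₀)]⁻¹ ∘ F'_v(t₀,v₀,ε₀)‖`. -/
theorem stmt_4
    {T V E Z : Type*}
    [NormedAddCommGroup T] [NormedSpace ℝ T] [CompleteSpace T]
    [NormedAddCommGroup V] [NormedSpace ℝ V] [CompleteSpace V]
    [NormedAddCommGroup E] [NormedSpace ℝ E] [CompleteSpace E]
    [NormedAddCommGroup Z] [NormedSpace ℝ Z] [CompleteSpace Z]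
    (t₀ : T) (v₀ : V) (ε₀ : E) (r : ℝ) (hr : 0 < r)
    (F : T → V → E → Z)
    (D : T × V × E →L[ℝ] Z) (Dt : T ≃L[ℝ] Z) (Dv : V →L[ℝ] Z)
    (L₂ : E × V → ℝ) (K : ℝ) (L₁ : E → ℝ)
    -- (i)
    (hi : F t₀ v₀ ε₀ = 0)
    -- (ii)
    (hii : ContinuousAt (fun p : T × V × E => F p.1 p.2.1 p.2.2) (t₀, v₀, ε₀))
    -- (iii): F is differentiable at (t₀,v₀,ε₀); Dt is the partial derivative
    -- in t (a continuous linear equivalence, i.e. it has a bounded inverse)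
    -- and Dv is the partial derivative in v
    (hiii : HasFDerivAt (fun p : T × V × E => F p.1 p.2.1 p.2.2) D (t₀, v₀, ε₀))
    (hDt : ∀ t : T, Dt t = D (t, 0, 0))
    (hDv : ∀ v : V, Dv v = D (0, v, 0))
    -- (iv)
    (hL₂ : Tendsto L₂ (nhds (ε₀, v₀)) (nhds 0))
    (hiv : ∀ t₁ ∈ ball t₀ r, ∀ t₂ ∈ ball t₀ r, ∀ v ∈ ball v₀ r, ∀ ε ∈ ball ε₀ r,
      ‖F t₁ v ε - F t₂ v ε - F t₁ v₀ ε₀ + F t₂ v₀ ε₀‖ ≤ L₂ (ε, v) * ‖t₁ - t₂‖)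
    -- (v)
    (hK : 0 < K)
    (hL₁ : Tendsto L₁ (nhds ε₀) (nhds 0))
    (hv : ∀ t₁ ∈ ball t₀ r, ∀ t₂ ∈ ball t₀ r, ∀ v₁ ∈ ball v₀ r, ∀ v₂ ∈ ball v₀ r,
      ∀ ε ∈ ball ε₀ r,
      ‖F t₁ v₂ ε - F t₁ v₁ ε - F t₂ v₂ ε₀ + F t₂ v₁ ε₀‖ ≤
        (L₁ ε + K * ‖t₁ - t₂‖) * ‖v₁ - v₂‖)
    -- (vi)
    (hvi : ContDiffOn ℝ 1 (fun p : T × V => F p.1 p.2 ε₀) (ball t₀ r ×ˢ ball v₀ r))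
    -- (vii)
    (hvii : ∃ c : NNReal, LipschitzOnWith c
      (fun p : T × V × E => F p.1 p.2.1 p.2.2)
      (ball t₀ r ×ˢ ball v₀ r ×ˢ ball ε₀ r))
    -- (viii): a norming functional map on T, bounded on bounded sets
    (J : T → (T →L[ℝ] ℝ))
    (hJ : ∀ t : T, J t t = ‖t‖)
    (hJbdd : ∀ s : Set T, Bornology.IsBounded s →
      Bornology.IsBounded ((fun t => J t) '' s)) :
    ∃ α > 0, ∃ β > 0, ∃ θ : V → E → T,
      (∀ v : V, ∀ ε : E, (v, ε) ∈ ball (v₀, ε₀) α →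
        (θ v ε ∈ ball t₀ β ∧ F (θ v ε) v ε = 0 ∧
          ∀ t ∈ ball t₀ β, F t v ε = 0 → t = θ v ε)) ∧
      ∀ Δ > 0, ∃ δ > 0, ∀ v₁ ∈ ball v₀ δ, ∀ v₂ ∈ ball v₀ δ, ∀ ε ∈ ball ε₀ δ,
        ‖θ v₁ ε - θ v₂ ε‖ ≤
          (‖((Dt.symm : Z →L[ℝ] T).comp Dv : V →L[ℝ] T)‖ + Δ) * ‖v₁ - v₂‖ := by
  set A : Z →L[ℝ] T := (Dt.symm : Z →L[ℝ] T) with hA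
  have hADt : ∀ t, A (Dt t) = t := fun t => by simp [hA]
  -- strict differentiability of the unperturbed map
  have hstrict : HasStrictFDerivAt (fun p : T × V => F p.1 p.2 ε₀)
      (D.comp ((ContinuousLinearMap.fst ℝ T V).prod
        ((ContinuousLinearMap.snd ℝ T V).prod 0))) (t₀, v₀) := by
    have hn : ball t₀ r ×ˢ ball v₀ r ∈ nhds (t₀, v₀) :=
      prod_mem_nhds (ball_mem_nhds _ hr) (ball_mem_nhds _ hr)
    refine (hvi.contDiffAt hn).hasStrictFDerivAt' ?_ (by norm_num)
    have hin : HasFDerivAt (fun p : T × V => ((p.1, p.2, ε₀) : T × V × E))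
        ((ContinuousLinearMap.fst ℝ T V).prod
        ((ContinuousLinearMap.snd ℝ T V).prod 0)) (t₀, v₀) :=
      hasFDerivAt_fst.prodMk (hasFDerivAt_snd.prodMk (hasFDerivAt_const _ _))
    exact HasFDerivAt.comp (g := fun p : T × V × E => F p.1 p.2.1 p.2.2) (t₀, v₀) hiii hin
  have key : ∀ η > 0, ∃ ρ > 0, ρ ≤ r ∧ ∀ ε ∈ ball ε₀ ρ, 
      (∀ t₁ ∈ ball t₀ ρ, ∀ t₂ ∈ ball t₀ ρ, ∀ v ∈ ball v₀ ρ,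
        ‖(t₁ - t₂) - A (F t₁ v ε - F t₂ v ε)‖ ≤ η * ‖t₁ - t₂‖) ∧
      (∀ t ∈ ball t₀ ρ, ∀ v₁ ∈ ball v₀ ρ, ∀ v₂ ∈ ball v₀ ρ,
        ‖A (F t v₁ ε - F t v₂ ε) - A (Dv (v₁ - v₂))‖ ≤ η * ‖v₁ - v₂‖) := by
    intro η hη
    obtain ⟨c, hc, hcη⟩ : ∃ c > 0, ‖A‖ * (c + c) ≤ η := by
      refine ⟨η / (2 * (‖A‖ + 1)), by positivity, ?_⟩
      have : 0 ≤ ‖A‖ := norm_nonneg A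
      have h2 : ‖A‖ * (η / (2 * (‖A‖ + 1)) + η / (2 * (‖A‖ + 1))) = η * (‖A‖ / (‖A‖ + 1)) := by
        field_simp
        ring
      rw [h2]
      have : ‖A‖ / (‖A‖ + 1) ≤ 1 := by
        rw [div_le_one (by positivity)]; linarith
      nlinarith
    have e1 := hstrict.isLittleO.def hc
    rw [nhds_prod_eq] at e1
    obtain ⟨ρ₁, hρ₁, h1⟩ : ∃ ρ₁ > 0, ∀ t₁ ∈ ball t₀ ρ₁, ∀ t₂ ∈ ball t₀ ρ₁, ∀ v₁ ∈ ball v₀ ρ₁,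
        ∀ v₂ ∈ ball v₀ ρ₁, ‖F t₁ v₁ ε₀ - F t₂ v₂ ε₀ - D (t₁ - t₂, v₁ - v₂, 0)‖
          ≤ c * ‖((t₁ - t₂, v₁ - v₂) : T × V)‖ := by
      rw [← nhds_prod_eq] at e1
      obtain ⟨ρ₁, hρ₁, h⟩ := Metric.eventually_nhds_iff_ball.1 e1
      refine ⟨ρ₁, hρ₁, fun t₁ ht₁ t₂ ht₂ v₁ hv₁ v₂ hv₂ => ?_⟩
      have := h ((t₁, v₁), (t₂, v₂)) (by
        rw [← ball_prod_same, ← ball_prod_same]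
        exact ⟨⟨ht₁, hv₁⟩, ⟨ht₂, hv₂⟩⟩)
      simpa using this
    obtain ⟨ρ₂, hρ₂, h2⟩ := Metric.eventually_nhds_iff_ball.1 (hL₂.eventually (gt_mem_nhds hc))
    obtain ⟨ρ₃, hρ₃, h3⟩ := Metric.eventually_nhds_iff_ball.1 (hL₁.eventually (gt_mem_nhds hc))
    refine ⟨min (min r ρ₁) (min ρ₂ ρ₃), by positivity, by simp, ?_⟩
    have b0 : min (min r ρ₁) (min ρ₂ ρ₃) ≤ r := by simp
    have b1 : min (min r ρ₁) (min ρ₂ ρ₃) ≤ ρ₁ := by simp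
    have b2 : min (min r ρ₁) (min ρ₂ ρ₃) ≤ ρ₂ := by simp
    have b3 : min (min r ρ₁) (min ρ₂ ρ₃) ≤ ρ₃ := by simp
    generalize min (min r ρ₁) (min ρ₂ ρ₃) = ρ at b0 b1 b2 b3
    have hv₀r : v₀ ∈ ball v₀ r := mem_ball_self hr
    intro ε hε
    constructor
    · intro t₁ ht₁ t₂ ht₂ v hv'
      have k1 := h1 t₁ (ball_subset_ball b1 ht₁) t₂ (ball_subset_ball b1 ht₂) v₀
        (mem_ball_self hρ₁) v₀ (mem_ball_self hρ₁)
      have k2 := hiv t₁ (ball_subset_ball b0 ht₁) t₂ (ball_subset_ball b0 ht₂) v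
        (ball_subset_ball b0 hv') ε (ball_subset_ball b0 hε)
      have k3 : L₂ (ε, v) < c := h2 (ε, v) (by
        rw [← ball_prod_same]
        exact ⟨ball_subset_ball b2 hε, ball_subset_ball b2 hv'⟩)
      rw [sub_self, ← hDt] at k1
      have k4 : ‖((t₁ - t₂, (0 : V)) : T × V)‖ = ‖t₁ - t₂‖ := by simp [Prod.norm_def]
      rw [k4] at k1
      have k5 : (t₁ - t₂) - A (F t₁ v ε - F t₂ v ε) =
          -A ((F t₁ v ε - F t₂ v ε - F t₁ v₀ ε₀ + F t₂ v₀ ε₀) +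
            (F t₁ v₀ ε₀ - F t₂ v₀ ε₀ - Dt (t₁ - t₂))) := by
        rw [← map_neg]
        nth_rw 1 [← hADt (t₁ - t₂)]
        rw [← map_sub]
        congr 1
        abel
      rw [k5, norm_neg]
      refine (A.le_opNorm _).trans ?_
      calc _ ≤ ‖A‖ * (c * ‖t₁ - t₂‖ + c * ‖t₁ - t₂‖) := by
            refine mul_le_mul_of_nonneg_left ?_ (norm_nonneg _)
            refine (norm_add_le _ _).trans (add_le_add (k2.trans ?_) k1)
            exact mul_le_mul_of_nonneg_right k3.le (norm_nonneg _)
        _ = ‖A‖ * (c + c) * ‖t₁ - t₂‖ := by ring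
        _ ≤ _ := mul_le_mul_of_nonneg_right hcη (norm_nonneg _)
    · intro t ht v₁ hv₁ v₂ hv₂
      have k1 := h1 t (ball_subset_ball b1 ht) t (ball_subset_ball b1 ht) v₁
        (ball_subset_ball b1 hv₁) v₂ (ball_subset_ball b1 hv₂)
      have k2 := hv t (ball_subset_ball b0 ht) t (ball_subset_ball b0 ht) v₂
        (ball_subset_ball b0 hv₂) v₁ (ball_subset_ball b0 hv₁) ε (ball_subset_ball b0 hε)
      have k3 : L₁ ε < c := h3 ε (ball_subset_ball b3 hε)
      rw [sub_self, ← hDv] at k1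
      have k4 : ‖(((0 : T), v₁ - v₂) : T × V)‖ = ‖v₁ - v₂‖ := by simp [Prod.norm_def]
      rw [k4] at k1
      rw [sub_self, norm_zero, mul_zero, add_zero, norm_sub_rev v₂ v₁] at k2
      have k5 : A (F t v₁ ε - F t v₂ ε) - A (Dv (v₁ - v₂)) =
          A ((F t v₁ ε - F t v₂ ε - F t v₁ ε₀ + F t v₂ ε₀) +
            (F t v₁ ε₀ - F t v₂ ε₀ - Dv (v₁ - v₂))) := by
        rw [← map_sub]
        congr 1
        abel
      rw [k5]
      refine (A.le_opNorm _).trans ?_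
      calc _ ≤ ‖A‖ * (c * ‖v₁ - v₂‖ + c * ‖v₁ - v₂‖) := by
            refine mul_le_mul_of_nonneg_left ?_ (norm_nonneg _)
            refine (norm_add_le _ _).trans (add_le_add (k2.trans ?_) k1)
            exact mul_le_mul_of_nonneg_right k3.le (norm_nonneg _)
        _ = ‖A‖ * (c + c) * ‖v₁ - v₂‖ := by ring
        _ ≤ _ := mul_le_mul_of_nonneg_right hcη (norm_nonneg _)
  -- smallness of the residual
  have hres : ∀ η > 0, ∃ ρ > 0, ∀ v ∈ ball v₀ ρ, ∀ ε ∈ ball ε₀ ρ, ‖A (F t₀ v ε)‖ < η := by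
    intro η hη
    have hc : ContinuousAt (fun p : V × E => ‖A (F t₀ p.1 p.2)‖) (v₀, ε₀) := by
      have hin : ContinuousAt (fun p : V × E => ((t₀, p.1, p.2) : T × V × E)) (v₀, ε₀) := by
        fun_prop
      have h1 : ContinuousAt (fun p : V × E => F t₀ p.1 p.2) (v₀, ε₀) :=
        ContinuousAt.comp (g := fun p : T × V × E => F p.1 p.2.1 p.2.2)
          (f := fun p : V × E => ((t₀, p.1, p.2) : T × V × E)) hii hin
      exact (A.continuous.continuousAt.comp h1).norm
    have h0 : ‖A (F t₀ v₀ ε₀)‖ < η := by rw [hi]; simpa using hη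
    obtain ⟨ρ, hρ, h⟩ := Metric.eventually_nhds_iff_ball.1 (hc.eventually (gt_mem_nhds h0))
    refine ⟨ρ, hρ, fun v hv' ε hε => h (v, ε) ?_⟩
    rw [← ball_prod_same]
    exact ⟨hv', hε⟩
  obtain ⟨β, hβ, hβr, hkey⟩ := key (1 / 2) (by norm_num)
  obtain ⟨ρ, hρ, hsmall⟩ := hres (β / 4) (by positivity)
  have hex : ∀ v : V, ∀ ε : E, ∃ t : T, (v, ε) ∈ ball (v₀, ε₀) (min β ρ) →
      t ∈ ball t₀ β ∧ F t v ε = 0 := by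
    intro v ε
    by_cases hmem : (v, ε) ∈ ball (v₀, ε₀) (min β ρ)
    swap
    · exact ⟨t₀, fun h => absurd h hmem⟩
    rw [← ball_prod_same] at hmem
    have hv' := hmem.1
    have hε := hmem.2
    have hvβ : v ∈ ball v₀ β := ball_subset_ball (min_le_left _ _) hv'
    have hεβ : ε ∈ ball ε₀ β := ball_subset_ball (min_le_left _ _) hε
    have hs := hsmall v (ball_subset_ball (min_le_right _ _) hv') ε
      (ball_subset_ball (min_le_right _ _) hε)
    have hcon := (hkey ε hεβ).1
    have hsub : closedBall t₀ (β / 2) ⊆ ball t₀ β := closedBall_subset_ball (by linarith)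
    set G : T → T := fun t => t - A (F t v ε) with hG
    have hGl : ∀ t₁ ∈ ball t₀ β, ∀ t₂ ∈ ball t₀ β, ‖G t₁ - G t₂‖ ≤ 1 / 2 * ‖t₁ - t₂‖ := by
      intro t₁ ht₁ t₂ ht₂
      have := hcon t₁ ht₁ t₂ ht₂ v hvβ
      have e : G t₁ - G t₂ = (t₁ - t₂) - A (F t₁ v ε - F t₂ v ε) := by
        simp only [hG, map_sub]; abel
      rwa [e]
    have hmaps : Set.MapsTo G (closedBall t₀ (β / 2)) (closedBall t₀ (β / 2)) := by
      intro t ht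
      have h1 := hGl t (hsub ht) t₀ (mem_ball_self hβ)
      have h2 : ‖t - t₀‖ ≤ β / 2 := by rwa [mem_closedBall, dist_eq_norm] at ht
      rw [mem_closedBall, dist_eq_norm]
      have e : G t - t₀ = (G t - G t₀) - A (F t₀ v ε) := by simp only [hG]; abel
      rw [e]
      refine (norm_sub_le _ _).trans ?_
      linarith
    have hcw : ContractingWith (1 / 2 : NNReal) (hmaps.restrict G _ _) := by
      refine ⟨by
        rw [← NNReal.coe_lt_coe]; norm_num, LipschitzWith.of_dist_le_mul ?_⟩
      rintro ⟨x, hx⟩ ⟨y, hy⟩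
      have := hGl x (hsub hx) y (hsub hy)
      simpa [Subtype.dist_eq, dist_eq_norm] using this
    obtain ⟨y, hy, hfix, -⟩ := ContractingWith.exists_fixedPoint'
      (isClosed_closedBall (x := t₀) (ε := β / 2)).isComplete hmaps hcw
      (x := t₀) (mem_closedBall_self (by positivity)) (edist_ne_top _ _)
    refine ⟨y, fun _ => ⟨hsub hy, ?_⟩⟩
    have h0 : A (F y v ε) = 0 := by
      have : y - A (F y v ε) = y := hfix
      simpa using this
    simpa [hA] using h0
  choose θ hθ using hex
  refine ⟨min β ρ, by positivity, β, hβ, θ, ?_, ?_⟩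
  · intro v ε hmem
    obtain ⟨h1, h2⟩ := hθ v ε hmem
    refine ⟨h1, h2, fun t ht hF => ?_⟩
    rw [← ball_prod_same] at hmem
    have := (hkey ε (ball_subset_ball (min_le_left _ _) hmem.2)).1 t ht _ h1 v
      (ball_subset_ball (min_le_left _ _) hmem.1)
    rw [hF, h2, sub_self, map_zero, sub_zero] at this
    have h0 : ‖t - θ v ε‖ ≤ 0 := by linarith
    exact sub_eq_zero.1 (norm_le_zero_iff.1 h0)
  · intro Δ hΔ
    set N := ‖A.comp Dv‖ with hN
    have hN0 : 0 ≤ N := norm_nonneg _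
    obtain ⟨η, hη, hη1, hηΔ⟩ : ∃ η > 0, η < 1 ∧ η * (1 + N + Δ) = Δ := by
      refine ⟨Δ / (1 + N + Δ), by positivity, ?_, by field_simp⟩
      rw [div_lt_one (by positivity)]; linarith
    obtain ⟨σ, hσ, -, hk⟩ := key η hη
    obtain ⟨τ, hτ, hst⟩ := hres (σ / 2) (by positivity)
    refine ⟨min (min β ρ) (min σ τ), by positivity, ?_⟩
    have b0 : min (min β ρ) (min σ τ) ≤ min β ρ := by simp
    have b1 : min (min β ρ) (min σ τ) ≤ β := by simp
    have b2 : min (min β ρ) (min σ τ) ≤ σ := by simp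
    have b3 : min (min β ρ) (min σ τ) ≤ τ := by simp
    generalize min (min β ρ) (min σ τ) = δ at b0 b1 b2 b3
    intro v₁ hv₁ v₂ hv₂ ε hε
    have hθσ : ∀ v ∈ ball v₀ δ, F (θ v ε) v ε = 0 ∧ θ v ε ∈ ball t₀ σ := by
      intro v hv'
      obtain ⟨h1, h2⟩ := hθ v ε (by
        rw [← ball_prod_same]
        exact ⟨ball_subset_ball b0 hv', ball_subset_ball b0 hε⟩)
      refine ⟨h2, ?_⟩
      have h3 := (hkey ε (ball_subset_ball b1 hε)).1 _ h1 t₀ (mem_ball_self hβ) v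
        (ball_subset_ball b1 hv')
      have h4 := hst v (ball_subset_ball b3 hv') ε (ball_subset_ball b3 hε)
      rw [h2, zero_sub, map_neg] at h3
      have h5 := norm_sub_le ((θ v ε - t₀) - -A (F t₀ v ε)) (A (F t₀ v ε))
      have e : (θ v ε - t₀) - -A (F t₀ v ε) - A (F t₀ v ε) = θ v ε - t₀ := by abel
      rw [e] at h5
      rw [mem_ball, dist_eq_norm]
      linarith
    obtain ⟨f1, m1⟩ := hθσ v₁ hv₁
    obtain ⟨f2, m2⟩ := hθσ v₂ hv₂
    have q1 := (hk ε (ball_subset_ball b2 hε)).1 _ m1 _ m2 v₁ (ball_subset_ball b2 hv₁)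
    have q2 := (hk ε (ball_subset_ball b2 hε)).2 _ m2 v₁ (ball_subset_ball b2 hv₁) v₂
      (ball_subset_ball b2 hv₂)
    have q3 : ‖A (Dv (v₁ - v₂))‖ ≤ N * ‖v₁ - v₂‖ := (A.comp Dv).le_opNorm (v₁ - v₂)
    rw [f1] at q1
    rw [f2] at q2
    have e : θ v₁ ε - θ v₂ ε = ((θ v₁ ε - θ v₂ ε) - A (0 - F (θ v₂ ε) v₁ ε))
        - (A (F (θ v₂ ε) v₁ ε - 0) - A (Dv (v₁ - v₂))) - A (Dv (v₁ - v₂)) := by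
      simp only [map_sub, map_zero]; abel
    have q4 : ‖θ v₁ ε - θ v₂ ε‖ ≤ η * ‖θ v₁ ε - θ v₂ ε‖ + η * ‖v₁ - v₂‖ + N * ‖v₁ - v₂‖ := by
      conv_lhs => rw [e]
      exact (norm_sub_le _ _).trans (add_le_add ((norm_sub_le _ _).trans (add_le_add q1 q2)) q3)
    have e2 : η + N = (1 - η) * (N + Δ) := by linarith
    have q5 : (1 - η) * ‖θ v₁ ε - θ v₂ ε‖ ≤ (1 - η) * ((N + Δ) * ‖v₁ - v₂‖) := by
      rw [← mul_assoc, ← e2]; linarith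
    exact le_of_mul_le_mul_left q5 (by linarith)
end

section
/- Let T, V, E, Z be real Banach spaces, t₀ ∈ T, v₀ ∈ V, ε₀ ∈ E, r > 0, and let F : B_r(t₀) × B_r(v₀) × B_r(ε₀) → Z satisfy assumptions (i)–(viii) of the perturbation theorem: F(t₀,v₀,ε₀) = 0; F continuous at (t₀,v₀,ε₀); F Fréchet differentiable at (t₀,v₀,ε₀) with F'_t(t₀,v₀,ε₀) boundedly invertible; ‖F(t₁,v,ε) − F(t₂,v,ε) − F(t₁,v₀,ε₀) + F(t₂,v₀,ε₀)‖ ≤ L_{ε,v}‖t₁ − t₂‖ with L_{ε,v} → 0 as (ε,v) → (ε₀,v₀); ‖F(t₁,v₂,ε) − F(t₁,v₁,ε) − F(t₂,v₂,ε₀) + F(t₂,v₁,ε₀)‖ ≤ (L_ε + K‖t₁ − t₂‖)‖v₁ − v₂‖ with L_ε → 0 as ε → ε₀; (t,v) ↦ F(t,v,ε₀) continuously differentiable; F Lipschitz; and a norming map J : T → T* with J(t)(t) = ‖t‖ bounded on bounded sets. Let θ(v,ε) denote the unique solution t ∈ B_β(t₀) of F(t,v,ε) = 0 for (v,ε) near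 (v₀,ε₀). Then for every Δ > 0 there exists δ > 0 such that ‖θ(v₁,ε) − θ(v₂,ε) − (θ(v₁,ε₀) − θ(v₂,ε₀))‖ ≤ (Δ/2)‖v₁ − v₂‖ for (i.e., for) all v₁,v₂ ∈ B_δ(v₀) and ε ∈ B_δ(ε₀). -/
open Metric Filter

/-- The key step in the proof of Theorem 2: the Lipschitz constant of
`v ↦ θ(v,ε) − θ(v,ε₀)` goes to `0`, i.e. for every `Δ > 0` there is `δ > 0`
with `‖θ(v₁,ε) − θ(v₂,ε) − (θ(v₁,ε₀) − θ(v₂,ε₀))‖ ≤ (Δ/2)‖v₁ − v₂‖` on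
`B_δ(v₀) × B_δ(ε₀)`. -/
theorem stmt_5
    {T V E Z : Type*}
    [NormedAddCommGroup T] [NormedSpace ℝ T] [CompleteSpace T]
    [NormedAddCommGroup V] [NormedSpace ℝ V] [CompleteSpace V]
    [NormedAddCommGroup E] [NormedSpace ℝ E] [CompleteSpace E]
    [NormedAddCommGroup Z] [NormedSpace ℝ Z] [CompleteSpace Z]
    (t₀ : T) (v₀ : V) (ε₀ : E) (r : ℝ) (hr : 0 < r)
    (F : T → V → E → Z)
    (D : T × V × E →L[ℝ] Z) (Dt : T ≃L[ℝ] Z)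
    (L₂ : E × V → ℝ) (K : ℝ) (L₁ : E → ℝ)
    -- (i)
    (hi : F t₀ v₀ ε₀ = 0)
    -- (ii)
    (hii : ContinuousAt (fun p : T × V × E => F p.1 p.2.1 p.2.2) (t₀, v₀, ε₀))
    -- (iii): F is differentiable at (t₀,v₀,ε₀); Dt is the partial derivative
    -- in t and it has a bounded inverse
    (hiii : HasFDerivAt (fun p : T × V × E => F p.1 p.2.1 p.2.2) D (t₀, v₀, ε₀))
    (hDt : ∀ t : T, Dt t = D (t, 0, 0))
    -- (iv)
    (hL₂ : Tendsto L₂ (nhds (ε₀, v₀)) (nhds 0))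
    (hiv : ∀ t₁ ∈ ball t₀ r, ∀ t₂ ∈ ball t₀ r, ∀ v ∈ ball v₀ r, ∀ ε ∈ ball ε₀ r,
      ‖F t₁ v ε - F t₂ v ε - F t₁ v₀ ε₀ + F t₂ v₀ ε₀‖ ≤ L₂ (ε, v) * ‖t₁ - t₂‖)
    -- (v)
    (hK : 0 < K)
    (hL₁ : Tendsto L₁ (nhds ε₀) (nhds 0))
    (hv : ∀ t₁ ∈ ball t₀ r, ∀ t₂ ∈ ball t₀ r, ∀ v₁ ∈ ball v₀ r, ∀ v₂ ∈ ball v₀ r,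
      ∀ ε ∈ ball ε₀ r,
      ‖F t₁ v₂ ε - F t₁ v₁ ε - F t₂ v₂ ε₀ + F t₂ v₁ ε₀‖ ≤
        (L₁ ε + K * ‖t₁ - t₂‖) * ‖v₁ - v₂‖)
    -- (vi)
    (hvi : ContDiffOn ℝ 1 (fun p : T × V => F p.1 p.2 ε₀) (ball t₀ r ×ˢ ball v₀ r))
    -- (vii)
    (hvii : ∃ c : NNReal, LipschitzOnWith c
      (fun p : T × V × E => F p.1 p.2.1 p.2.2)
      (ball t₀ r ×ˢ ball v₀ r ×ˢ ball ε₀ r))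
    -- (viii): a norming functional map on T, bounded on bounded sets
    (J : T → (T →L[ℝ] ℝ))
    (hJ : ∀ t : T, J t t = ‖t‖)
    (hJbdd : ∀ s : Set T, Bornology.IsBounded s →
      Bornology.IsBounded ((fun t => J t) '' s))
    -- θ is the implicit function: for (v,ε) near (v₀,ε₀), θ(v,ε) is the
    -- unique solution t ∈ B_β(t₀) of F(t,v,ε) = 0
    (α β : ℝ) (hα : 0 < α) (hβ : 0 < β) (θ : V → E → T)
    (hθ : ∀ v : V, ∀ ε : E, (v, ε) ∈ ball (v₀, ε₀) α →
      (θ v ε ∈ ball t₀ β ∧ F (θ v ε) v ε = 0 ∧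
        ∀ t ∈ ball t₀ β, F t v ε = 0 → t = θ v ε)) :
    ∀ Δ > 0, ∃ δ > 0, ∀ v₁ ∈ ball v₀ δ, ∀ v₂ ∈ ball v₀ δ, ∀ ε ∈ ball ε₀ δ,
      ‖θ v₁ ε - θ v₂ ε - (θ v₁ ε₀ - θ v₂ ε₀)‖ ≤ (Δ / 2) * ‖v₁ - v₂‖ := by
  intro Δ hΔ
  obtain ⟨c, hc⟩ := hvii
  -- constants
  obtain ⟨m, hm, hA⟩ : ∃ m : NNReal, 0 < m ∧ ∀ z, ‖Dt.symm z‖ ≤ m * ‖z‖ := by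
    refine ⟨‖(Dt.symm : Z →L[ℝ] T)‖₊ + 1, by positivity, fun z => ?_⟩
    have := (Dt.symm : Z →L[ℝ] T).le_opNorm z
    push_cast
    have h2 := norm_nonneg z
    simp only [ContinuousLinearEquiv.coe_coe, coe_nnnorm] at this ⊢
    nlinarith
  have hm' : (0 : ℝ) < m := hm
  set C : ℝ := c + 1 with hC
  have hCpos : 0 < C := by positivity
  obtain ⟨η, hη0, hη1, hη2⟩ : ∃ η : ℝ, 0 < η ∧ m * η ≤ 1 / 2 ∧ 4 * m * m * C * η ≤ Δ / 6 := by
    refine ⟨min (1 / (2 * m)) (Δ / 6 / (4 * m * m * C)), by positivity, ?_, ?_⟩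
    · calc (m : ℝ) * _ ≤ m * (1 / (2 * m)) := by gcongr; exact min_le_left _ _
        _ = 1 / 2 := by field_simp
    · calc 4 * (m : ℝ) * m * C * _ ≤ 4 * m * m * C * (Δ / 6 / (4 * m * m * C)) := by
            gcongr; exact min_le_right _ _
        _ = Δ / 6 := by field_simp
  -- strict differentiability of `F · v₀ ε₀`
  have hd : HasFDerivAt (fun t => F t v₀ ε₀) (Dt : T →L[ℝ] Z) t₀ := by
    have h1 : HasFDerivAt (fun t : T => ((t, v₀, ε₀) : T × V × E))
        ((ContinuousLinearMap.id ℝ T).prod (0 : T →L[ℝ] V × E)) t₀ :=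
      (hasFDerivAt_id t₀).prodMk (hasFDerivAt_const (v₀, ε₀) t₀)
    have h2 := HasFDerivAt.comp (g := fun p : T × V × E => F p.1 p.2.1 p.2.2) t₀ hiii h1
    have h3 : D.comp ((ContinuousLinearMap.id ℝ T).prod (0 : T →L[ℝ] V × E))
        = (Dt : T →L[ℝ] Z) := by
      ext t
      simp [hDt]
      rfl
    rw [h3] at h2
    exact h2
  have hs : HasStrictFDerivAt (fun t => F t v₀ ε₀) (Dt : T →L[ℝ] Z) t₀ := by
    have h1 : ContDiffAt ℝ 1 (fun p : T × V => F p.1 p.2 ε₀) (t₀, v₀) :=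
      hvi.contDiffAt (prod_mem_nhds (ball_mem_nhds _ hr) (ball_mem_nhds _ hr))
    have h2 : ContDiffAt ℝ 1 (fun t : T => (t, v₀)) t₀ := contDiffAt_id.prodMk contDiffAt_const
    have h3 : ContDiffAt ℝ 1 (fun t => F t v₀ ε₀) t₀ :=
      ContDiffAt.comp (g := fun p : T × V => F p.1 p.2 ε₀) t₀ h1 h2
    exact h3.hasStrictFDerivAt' hd (by simp)
  obtain ⟨s, hsn, hsa⟩ := hs.approximates_deriv_on_nhds
    (c := ⟨η / 2, by positivity⟩) (Or.inr (half_pos hη0))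
  obtain ⟨ρ₀, hρ₀, hsub⟩ := Metric.mem_nhds_iff.1 hsn
  obtain ⟨ρ, hρ, hρ1, hρ2, hρ3, hρ4⟩ : ∃ ρ : ℝ, 0 < ρ ∧ ρ < ρ₀ ∧ ρ < r ∧ ρ < β ∧
      m * (2 * K * ρ) ≤ Δ / 6 := by
    refine ⟨min (min (ρ₀ / 2) (r / 2)) (min (β / 2) (Δ / 6 / (m * (2 * K)))),
      by positivity, ?_, ?_, ?_, ?_⟩
    · exact ((min_le_left _ _).trans (min_le_left _ _)).trans_lt (by linarith)
    · exact ((min_le_left _ _).trans (min_le_right _ _)).trans_lt (by linarith)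
    · exact ((min_le_right _ _).trans (min_le_left _ _)).trans_lt (by linarith)
    · calc m * (2 * K * _) ≤ m * (2 * K * (Δ / 6 / (m * (2 * K)))) := by
            gcongr; exact (min_le_right _ _).trans (min_le_right _ _)
        _ = Δ / 6 := by field_simp
  -- choice of `δ`
  have e1 : ∀ᶠ p : V × E in nhds (v₀, ε₀), L₂ (p.2, p.1) < η / 2 := by
    have : Tendsto (fun p : V × E => L₂ (p.2, p.1)) (nhds (v₀, ε₀)) (nhds 0) :=
      hL₂.comp (continuous_swap.tendsto (v₀, ε₀))
    exact this.eventually_lt_const (by positivity)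
  have e2 : ∀ᶠ p : V × E in nhds (v₀, ε₀), L₁ p.2 < Δ / 6 / m := by
    have : Tendsto (fun p : V × E => L₁ p.2) (nhds (v₀, ε₀)) (nhds 0) :=
      hL₁.comp (continuous_snd.tendsto (v₀, ε₀))
    exact this.eventually_lt_const (by positivity)
  have e3 : ∀ᶠ p : V × E in nhds (v₀, ε₀), ‖F t₀ p.1 p.2‖ < ρ / (2 * m) := by
    have h1 : Tendsto (fun p : V × E => ((t₀, p.1, p.2) : T × V × E)) (nhds (v₀, ε₀))
        (nhds (t₀, v₀, ε₀)) :=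
      (by fun_prop : Continuous (fun p : V × E => ((t₀, p.1, p.2) : T × V × E))).tendsto (v₀, ε₀)
    have h2 := (hii.tendsto.comp h1).norm
    simp only [hi, norm_zero] at h2
    exact h2.eventually_lt_const (by positivity)
  have e4 : ∀ᶠ p : V × E in nhds (v₀, ε₀), p ∈ ball (v₀, ε₀) (min r α) :=
    ball_mem_nhds _ (by positivity)
  obtain ⟨δ, hδ, hall⟩ := Metric.eventually_nhds_iff_ball.1 (e1.and (e2.and (e3.and e4)))
  have key : ∀ v ∈ ball v₀ δ, ∀ ε ∈ ball ε₀ δ, v ∈ ball v₀ r ∧ ε ∈ ball ε₀ r ∧ L₁ ε < Δ / 6 / m ∧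
      θ v ε ∈ closedBall t₀ ρ ∧ F (θ v ε) v ε = 0 ∧
      ∀ x ∈ closedBall t₀ ρ, ∀ y ∈ closedBall t₀ ρ,
        ‖F x v ε - F y v ε - Dt (x - y)‖ ≤ η * ‖x - y‖ := by
    intro v hvv ε hε
    obtain ⟨g1, g2, g3, g4⟩ := hall (v, ε) (by
      rw [← ball_prod_same]; exact ⟨hvv, hε⟩)
    have g5 : (v, ε) ∈ ball (v₀, ε₀) r := ball_subset_ball (min_le_left _ _) g4
    have g6 : (v, ε) ∈ ball (v₀, ε₀) α := ball_subset_ball (min_le_right _ _) g4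
    rw [← ball_prod_same] at g5
    obtain ⟨g7, g8⟩ := g5
    simp only at g1 g2 g3 g7 g8
    have happ : ∀ x ∈ closedBall t₀ ρ, ∀ y ∈ closedBall t₀ ρ,
        ‖F x v ε - F y v ε - Dt (x - y)‖ ≤ η * ‖x - y‖ := by
      intro x hx y hy
      have h1 := hiv x (closedBall_subset_ball hρ2 hx) y (closedBall_subset_ball hρ2 hy) v g7 ε g8
      have h2 := hsa x (hsub (closedBall_subset_ball hρ1 hx)) y
        (hsub (closedBall_subset_ball hρ1 hy))
      have h2' : ‖F x v₀ ε₀ - F y v₀ ε₀ - Dt (x - y)‖ ≤ η / 2 * ‖x - y‖ := h2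
      have h3 : F x v ε - F y v ε - Dt (x - y) =
        (F x v ε - F y v ε - F x v₀ ε₀ + F y v₀ ε₀) + (F x v₀ ε₀ - F y v₀ ε₀ - Dt (x - y)) := by
        abel
      rw [h3]
      have h4 := norm_add_le (F x v ε - F y v ε - F x v₀ ε₀ + F y v₀ ε₀)
        (F x v₀ ε₀ - F y v₀ ε₀ - Dt (x - y))
      have h5 := mul_le_mul_of_nonneg_right g1.le (norm_nonneg (x - y))
      linarith
    have happ' : ApproximatesLinearOn (fun t => F t v ε) (Dt : T →L[ℝ] Z) (closedBall t₀ ρ)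
        ⟨η, hη0.le⟩ := fun x hx y hy => happ x hx y hy
    have hsurj := happ'.surjOn_closedBall_of_nonlinearRightInverse
      ⟨Dt.symm, m, hA, fun z => by simp⟩ hρ.le subset_rfl
    obtain ⟨t, ht, ht0⟩ := hsurj (a := 0) (by
      rw [mem_closedBall, dist_zero_left]
      refine g3.le.trans ?_
      change ρ / (2 * m) ≤ ((m : ℝ)⁻¹ - η) * ρ
      have : η ≤ 1 / (2 * m) := by
        rw [le_div_iff₀ (by positivity)]; linarith
      have h2 : (m : ℝ)⁻¹ = 1 / (2 * m) + 1 / (2 * m) := by field_simp; norm_num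
      calc ρ / (2 * m) = 1 / (2 * m) * ρ := by ring
        _ ≤ _ := by gcongr; linarith)
    obtain ⟨k1, k2, k3⟩ := hθ v ε g6
    have := k3 t (closedBall_subset_ball hρ3 ht) ht0
    exact ⟨g7, g8, g2, this ▸ ht, k2, happ⟩
  have hinv : ∀ x : T, ‖x‖ ≤ m * ‖Dt x‖ := fun x => by simpa using hA (Dt x)
  -- Lipschitz estimate for `θ`
  have lip : ∀ v₁ ∈ ball v₀ δ, ∀ v₂ ∈ ball v₀ δ, ∀ ε ∈ ball ε₀ δ,
      ‖θ v₁ ε - θ v₂ ε‖ ≤ 2 * m * C * ‖v₁ - v₂‖ := by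
    intro v₁ hv₁ v₂ hv₂ ε hε
    obtain ⟨p1, p2, p3, p4, p5, p6⟩ := key v₁ hv₁ ε hε
    obtain ⟨q1, q2, q3, q4, q5, q6⟩ := key v₂ hv₂ ε hε
    have h1 := p6 _ p4 _ q4
    have q4' := closedBall_subset_ball hρ2 q4
    have h2 := hc.norm_sub_le (x := (θ v₂ ε, v₁, ε)) (y := (θ v₂ ε, v₂, ε))
      ⟨q4', p1, p2⟩ ⟨q4', q1, p2⟩
    simp only [q5, Prod.mk_sub_mk, sub_self, sub_zero, Prod.norm_mk, norm_zero] at h2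
    rw [max_eq_left (norm_nonneg (v₁ - v₂)), max_eq_right (norm_nonneg (v₁ - v₂))] at h2
    rw [p5] at h1
    have h3 : Dt (θ v₁ ε - θ v₂ ε) = -(0 - F (θ v₂ ε) v₁ ε - Dt (θ v₁ ε - θ v₂ ε))
        - F (θ v₂ ε) v₁ ε := by abel
    have h4 : ‖Dt (θ v₁ ε - θ v₂ ε)‖ ≤ η * ‖θ v₁ ε - θ v₂ ε‖ + c * ‖v₁ - v₂‖ := by
      rw [h3]
      refine (norm_sub_le _ _).trans ?_
      rw [norm_neg]
      exact add_le_add h1 h2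
    have h5 := (hinv _).trans (mul_le_mul_of_nonneg_left h4 hm'.le)
    have h6 := mul_le_mul_of_nonneg_right hη1 (norm_nonneg (θ v₁ ε - θ v₂ ε))
    have h7 : 0 ≤ m * ‖v₁ - v₂‖ := by positivity
    rw [hC]
    nlinarith
  refine ⟨δ, hδ, fun v₁ hv₁ v₂ hv₂ ε hε => ?_⟩
  have hε₀ : ε₀ ∈ ball ε₀ δ := mem_ball_self hδ
  obtain ⟨p1, p2, p3, p4, p5, p6⟩ := key v₁ hv₁ ε hε
  obtain ⟨q1, q2, q3, q4, q5, q6⟩ := key v₂ hv₂ ε hε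
  obtain ⟨-, -, -, p4', p5', p6'⟩ := key v₁ hv₁ ε₀ hε₀
  obtain ⟨-, -, -, q4', q5', q6'⟩ := key v₂ hv₂ ε₀ hε₀
  have l1 := lip v₁ hv₁ v₂ hv₂ ε hε
  have l2 := lip v₁ hv₁ v₂ hv₂ ε₀ hε₀
  have h1 := p6 _ p4 _ q4
  have h2 := p6' _ p4' _ q4'
  have h3 := hv _ (closedBall_subset_ball hρ2 q4) _ (closedBall_subset_ball hρ2 q4') v₁ p1 v₂ q1
    ε p2
  have hab : ‖θ v₂ ε - θ v₂ ε₀‖ ≤ 2 * ρ := by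
    rw [← dist_eq_norm]
    have := dist_triangle_right (θ v₂ ε) (θ v₂ ε₀) t₀
    have h4 := mem_closedBall.1 q4
    have h5 := mem_closedBall.1 q4'
    linarith
  rw [p5] at h1
  rw [p5'] at h2
  rw [q5, q5'] at h3
  generalize θ v₁ ε = a₁ at *
  generalize θ v₂ ε = a₂ at *
  generalize θ v₁ ε₀ = b₁ at *
  generalize θ v₂ ε₀ = b₂ at *
  have h4 : Dt (a₁ - a₂ - (b₁ - b₂)) = -(0 - F a₂ v₁ ε - Dt (a₁ - a₂))
      + (0 - F b₂ v₁ ε₀ - Dt (b₁ - b₂)) + (0 - F a₂ v₁ ε - 0 + F b₂ v₁ ε₀) := by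
    rw [map_sub Dt (a₁ - a₂)]; abel
  have h5 : ‖Dt (a₁ - a₂ - (b₁ - b₂))‖ ≤ η * ‖a₁ - a₂‖ + η * ‖b₁ - b₂‖
      + (L₁ ε + K * ‖a₂ - b₂‖) * ‖v₁ - v₂‖ := by
    rw [h4]
    refine (norm_add₃_le).trans ?_
    rw [norm_neg]
    exact add_le_add (add_le_add h1 h2) h3
  have h6 : m * L₁ ε ≤ Δ / 6 := by
    rw [lt_div_iff₀ hm'] at p3; linarith
  have hw := norm_nonneg (v₁ - v₂)
  calc _ ≤ m * ‖Dt (a₁ - a₂ - (b₁ - b₂))‖ := hinv _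
    _ ≤ m * (η * (2 * m * C * ‖v₁ - v₂‖) + η * (2 * m * C * ‖v₁ - v₂‖)
      + (L₁ ε + K * (2 * ρ)) * ‖v₁ - v₂‖) := by
        refine mul_le_mul_of_nonneg_left (h5.trans ?_) hm'.le
        gcongr
    _ = (4 * m * m * C * η + m * L₁ ε + m * (2 * K * ρ)) * ‖v₁ - v₂‖ := by ring
    _ ≤ (Δ / 2) * ‖v₁ - v₂‖ := by
        refine mul_le_mul_of_nonneg_right ?_ hw
        linarith
end
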